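/- For all ℓ ≥ 2 and all n ≥ 5 + ℓ, the coefficient of x^{n-4-ℓ} in the polynomial Q_{n,132}^{(0,1,ℓ,2)}(x) equals 2·C_{ℓ+1} + 15·C_ℓ + 4·C_ℓ·(n-5-ℓ). -/

import Mathlib

open Finset Polynomial

/-- `σ i` matches the quadrant marked mesh pattern `MMP(a,b,c,d)` in `σ`:
there are at least `a` indices `j > i` with `σ j > σ i`, at least `b` indices
`j < i` with `σ j > σ i`, at least `c` indices `j < i` with `σ j < σ i`, and
at least `d` indices `j > i` with `σ j < σ i`. -/
def MatchesMMP {n : ℕ} (a b c d : ℕ) (σ : Equiv.Perm (Fin n)) (i : Fin n) : Prop :=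
  a ≤ (Finset.univ.filter (fun j => i < j ∧ σ i < σ j)).card ∧
  b ≤ (Finset.univ.filter (fun j => j < i ∧ σ i < σ j)).card ∧
  c ≤ (Finset.univ.filter (fun j => j < i ∧ σ j < σ i)).card ∧
  d ≤ (Finset.univ.filter (fun j => i < j ∧ σ j < σ i)).card

instance {n : ℕ} (a b c d : ℕ) (σ : Equiv.Perm (Fin n)) :
    DecidablePred (MatchesMMP a b c d σ) := fun i => by
  unfold MatchesMMP; infer_instance

/-- `mmp a b c d σ` is the number of indices `i` such that `σ i` matches
`MMP(a,b,c,d)` in `σ`. -/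
def mmp {n : ℕ} (a b c d : ℕ) (σ : Equiv.Perm (Fin n)) : ℕ :=
  (Finset.univ.filter (MatchesMMP a b c d σ)).card

/-- `σ` avoids the classical pattern 132. -/
def Avoids132 {n : ℕ} (σ : Equiv.Perm (Fin n)) : Prop :=
  ¬ ∃ i j k : Fin n, i < j ∧ j < k ∧ σ i < σ k ∧ σ k < σ j

instance {n : ℕ} : DecidablePred (Avoids132 (n := n)) := fun σ => by
  unfold Avoids132; infer_instance

/-- The set `S_n(132)` of 132-avoiding permutations of `{1,…,n}`. -/
def Av132 (n : ℕ) : Finset (Equiv.Perm (Fin n)) :=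
  Finset.univ.filter Avoids132

/-- `Q n a b c d = Σ_{σ ∈ S_n(132)} x^{mmp^{(a,b,c,d)}(σ)}`, a polynomial in `ℤ[x]`. -/
noncomputable def Q (n a b c d : ℕ) : Polynomial ℤ :=
  ∑ σ ∈ Av132 n, Polynomial.X ^ (mmp a b c d σ)


/-- glue `τ` (shifted up), the maximum, and `ρ`: value function -/
def combFun {i k : ℕ} (τ : Equiv.Perm (Fin i)) (ρ : Equiv.Perm (Fin k)) :
    Fin (i + 1 + k) → Fin (i + 1 + k) :=
  Fin.addCases
    (Fin.lastCases (⟨i + k, by omega⟩ : Fin (i + 1 + k))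
      (fun a => (⟨τ a + k, by have := (τ a).2; omega⟩ : Fin (i + 1 + k))))
    (fun b => ⟨ρ b, by have := (ρ b).2; omega⟩)

lemma combFun_left {i k : ℕ} (τ : Equiv.Perm (Fin i)) (ρ : Equiv.Perm (Fin k)) (a : Fin i) :
    ((combFun τ ρ (Fin.castAdd k (Fin.castSucc a))) : ℕ) = τ a + k := by
  simp [combFun]

lemma combFun_mid {i k : ℕ} (τ : Equiv.Perm (Fin i)) (ρ : Equiv.Perm (Fin k)) :
    ((combFun τ ρ (Fin.castAdd k (Fin.last i))) : ℕ) = i + k := by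
  simp [combFun]

lemma combFun_right {i k : ℕ} (τ : Equiv.Perm (Fin i)) (ρ : Equiv.Perm (Fin k)) (b : Fin k) :
    ((combFun τ ρ (Fin.natAdd (i + 1) b)) : ℕ) = ρ b := by
  simp [combFun]

lemma forall_pos {i k : ℕ} {p : Fin (i + 1 + k) → Prop} :
    (∀ x, p x) ↔ (∀ a : Fin i, p (Fin.castAdd k (Fin.castSucc a))) ∧
      p (Fin.castAdd k (Fin.last i)) ∧ ∀ b : Fin k, p (Fin.natAdd (i + 1) b) := by
  constructor
  · intro h; exact ⟨fun _ => h _, h _, fun _ => h _⟩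
  · rintro ⟨h1, h2, h3⟩ x
    induction x using Fin.addCases with
    | left y =>
      induction y using Fin.lastCases with
      | last => exact h2
      | cast a => exact h1 a
    | right b => exact h3 b

lemma combFun_injective {i k : ℕ} (τ : Equiv.Perm (Fin i)) (ρ : Equiv.Perm (Fin k)) :
    Function.Injective (combFun τ ρ) := by
  unfold Function.Injective
  simp only [forall_pos, Fin.ext_iff, combFun_left, combFun_mid, combFun_right]
  refine ⟨fun a => ⟨fun a' h => ?_, fun h => ?_, fun b h => ?_⟩,
    ⟨fun a' h => ?_, fun _ => trivial, fun b h => ?_⟩, fun b => ⟨fun a' h => ?_, fun h => ?_, fun b' h => ?_⟩⟩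
  · have : τ a = τ a' := Fin.ext (by omega)
    simp [τ.injective this]
  · have := (τ a).2; omega
  · have := (ρ b).2; omega
  · have := (τ a').2; omega
  · have := (ρ b).2; omega
  · have := (ρ b).2; omega
  · have := (ρ b).2; omega
  · have : ρ b = ρ b' := Fin.ext (by omega)
    simp [ρ.injective this]

noncomputable def comb {i k : ℕ} (τ : Equiv.Perm (Fin i)) (ρ : Equiv.Perm (Fin k)) :
    Equiv.Perm (Fin (i + 1 + k)) :=
  Equiv.ofBijective (combFun τ ρ) (Finite.injective_iff_bijective.1 (combFun_injective τ ρ))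

lemma comb_left {i k : ℕ} (τ : Equiv.Perm (Fin i)) (ρ : Equiv.Perm (Fin k)) (a : Fin i) :
    ((comb τ ρ (Fin.castAdd k (Fin.castSucc a))) : ℕ) = τ a + k := combFun_left τ ρ a

lemma comb_mid {i k : ℕ} (τ : Equiv.Perm (Fin i)) (ρ : Equiv.Perm (Fin k)) :
    ((comb τ ρ (Fin.castAdd k (Fin.last i))) : ℕ) = i + k := combFun_mid τ ρ

lemma comb_right {i k : ℕ} (τ : Equiv.Perm (Fin i)) (ρ : Equiv.Perm (Fin k)) (b : Fin k) :
    ((comb τ ρ (Fin.natAdd (i + 1) b)) : ℕ) = ρ b := combFun_right τ ρ b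

lemma card_pos3 {i k : ℕ} (p : Fin (i + 1 + k) → Prop) [DecidablePred p] :
    (univ.filter p).card = (univ.filter fun a : Fin i => p (Fin.castAdd k (Fin.castSucc a))).card +
      (if p (Fin.castAdd k (Fin.last i)) then 1 else 0) +
      (univ.filter fun b : Fin k => p (Fin.natAdd (i + 1) b)).card := by
  simp only [Finset.card_filter, Fin.sum_univ_add, Fin.sum_univ_castSucc]

lemma match_left {i k : ℕ} (τ : Equiv.Perm (Fin i)) (ρ : Equiv.Perm (Fin k)) (a b c d : ℕ)
    (x : Fin i) : MatchesMMP a b c d (comb τ ρ) (Fin.castAdd k (Fin.castSucc x)) ↔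
      MatchesMMP (a - 1) b c (d - k) τ x := by
  have hx := (τ x).2
  have hx' := x.2
  have h1 : ∀ y : Fin k, ¬ ((τ x : ℕ) + k < ρ y) := fun y => by have := (ρ y).2; omega
  have h2 : ∀ y : Fin k, (ρ y : ℕ) < (τ x : ℕ) + k := fun y => by have := (ρ y).2; omega
  have h3 : ∀ y : Fin k, (x : ℕ) < i + 1 + y := fun y => by omega
  have h4 : ∀ y : Fin k, ¬ (i + 1 + (y : ℕ) < x) := fun y => by omega
  have h5 : ¬ (i < (x : ℕ)) := by omega
  have h6 : ¬ (i < (τ x : ℕ)) := by omega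
  simp only [MatchesMMP, card_pos3, Fin.lt_def, comb_left, comb_mid, comb_right, Fin.val_castAdd,
    Fin.val_castSucc, Fin.val_last, Fin.val_natAdd, h1, h2, h3, h4, h5, h6, hx, hx', add_lt_add_iff_right]
  simp

lemma match_mid {i k : ℕ} (τ : Equiv.Perm (Fin i)) (ρ : Equiv.Perm (Fin k)) (a b c d : ℕ) :
    MatchesMMP a b c d (comb τ ρ) (Fin.castAdd k (Fin.last i)) ↔
      a = 0 ∧ b = 0 ∧ c ≤ i ∧ d ≤ k := by
  have h1 : ∀ y : Fin k, (ρ y : ℕ) < i + k := fun y => by have := (ρ y).2; omega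
  have h2 : ∀ y : Fin k, ¬ (i + k < (ρ y : ℕ)) := fun y => by have := (ρ y).2; omega
  have h3 : ∀ y : Fin k, i < i + 1 + (y : ℕ) := fun y => by omega
  have h4 : ∀ y : Fin k, ¬ (i + 1 + (y : ℕ) < i) := fun y => by omega
  have h5 : ∀ y : Fin i, ¬ (i < (y : ℕ)) := fun y => by omega
  simp only [MatchesMMP, card_pos3, Fin.lt_def, comb_left, comb_mid, comb_right, Fin.val_castAdd,
    Fin.val_castSucc, Fin.val_last, Fin.val_natAdd, h1, h2, h3, h4, h5, add_lt_add_iff_right]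
  simp

lemma match_right {i k : ℕ} (τ : Equiv.Perm (Fin i)) (ρ : Equiv.Perm (Fin k)) (a b c d : ℕ)
    (x : Fin k) : MatchesMMP a b c d (comb τ ρ) (Fin.natAdd (i + 1) x) ↔
      MatchesMMP a (b - (i + 1)) c d ρ x := by
  have hx := (ρ x).2
  have hx' := x.2
  have h1 : ∀ y : Fin i, ¬ ((τ y : ℕ) + k < ρ x) := fun y => by omega
  have h2 : ∀ y : Fin i, (ρ x : ℕ) < (τ y : ℕ) + k := fun y => by omega
  have h3 : ∀ y : Fin i, (y : ℕ) < i + 1 + x := fun y => by omega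
  have h4 : ∀ y : Fin i, ¬ (i + 1 + (x : ℕ) < y) := fun y => by omega
  have h5 : ¬ (i + 1 + (x : ℕ) < i) := by omega
  have h6 : ¬ (i + k < (ρ x : ℕ)) := by omega
  have h7 : (ρ x : ℕ) < i + k := by omega
  have h8 : i < i + 1 + (x : ℕ) := by omega
  simp only [MatchesMMP, card_pos3, Fin.lt_def, comb_left, comb_mid, comb_right, Fin.val_castAdd,
    Fin.val_castSucc, Fin.val_last, Fin.val_natAdd, h1, h2, h3, h4, h5, h6, h7, h8,
    add_lt_add_iff_left]
  simp [add_comm]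

lemma mmp_comb {i k : ℕ} (τ : Equiv.Perm (Fin i)) (ρ : Equiv.Perm (Fin k)) (a b c d : ℕ) :
    mmp a b c d (comb τ ρ) = mmp (a - 1) b c (d - k) τ +
      (if a = 0 ∧ b = 0 ∧ c ≤ i ∧ d ≤ k then 1 else 0) + mmp a (b - (i + 1)) c d ρ := by
  unfold mmp
  rw [card_pos3]
  simp only [match_left, match_mid, match_right]

lemma avoids_comb {i k : ℕ} (τ : Equiv.Perm (Fin i)) (ρ : Equiv.Perm (Fin k)) :
    Avoids132 (comb τ ρ) ↔ Avoids132 τ ∧ Avoids132 ρ := by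
  unfold Avoids132
  push Not
  constructor
  · intro h
    constructor
    · intro x y z h1 h2 h3
      have := h (Fin.castAdd k (Fin.castSucc x)) (Fin.castAdd k (Fin.castSucc y))
        (Fin.castAdd k (Fin.castSucc z))
      simp only [Fin.lt_def, Fin.le_def, comb_left, Fin.val_castAdd, Fin.val_castSucc] at this h1 h2 h3 ⊢
      have := this h1 h2 (by omega)
      omega
    · intro x y z h1 h2 h3
      have := h (Fin.natAdd (i + 1) x) (Fin.natAdd (i + 1) y) (Fin.natAdd (i + 1) z)
      simp only [Fin.lt_def, Fin.le_def, comb_right, Fin.val_natAdd] at this h1 h2 h3 ⊢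
      exact this (by omega) (by omega) h3
  · rintro ⟨h1, h2⟩
    simp only [Fin.lt_def, Fin.le_def] at h1 h2
    simp only [forall_pos, Fin.lt_def, Fin.le_def, comb_left, comb_mid, comb_right, Fin.val_castAdd,
      Fin.val_castSucc, Fin.val_last, Fin.val_natAdd]
    refine ⟨fun x => ⟨fun y => ⟨fun z p q r => ?_, ?_, ?_⟩, ⟨?_, ?_, ?_⟩, fun y => ⟨?_, ?_, ?_⟩⟩,
      ⟨fun y => ⟨?_, ?_, ?_⟩, ⟨?_, ?_, ?_⟩, fun y => ⟨?_, ?_, ?_⟩⟩,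
      fun x => ⟨fun y => ⟨?_, ?_, ?_⟩, ⟨?_, ?_, ?_⟩, fun y => ⟨?_, ?_, fun z p q r => ?_⟩⟩⟩
    · have := h1 x y z p q (by omega); omega
    on_goal 26 => exact h2 x y z (by omega) (by omega) r
    all_goals intros; omega

lemma comb_surj {i k : ℕ} (σ : Equiv.Perm (Fin (i + 1 + k))) (hσ : Avoids132 σ)
    (hm : (σ (Fin.castAdd k (Fin.last i)) : ℕ) = i + k) :
    ∃ (τ : Equiv.Perm (Fin i)) (ρ : Equiv.Perm (Fin k)), comb τ ρ = σ := by
  have key : ∀ (a : Fin i) (b : Fin k), (σ (Fin.natAdd (i + 1) b) : ℕ) <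
      σ (Fin.castAdd k (Fin.castSucc a)) := by
    intro a b
    by_contra hcon
    push Not at hcon
    apply hσ
    have hne : (σ (Fin.natAdd (i + 1) b) : ℕ) ≠ σ (Fin.castAdd k (Fin.castSucc a)) := by
      intro h
      have := σ.injective (Fin.ext h)
      simp only [Fin.ext_iff, Fin.val_castAdd, Fin.val_castSucc, Fin.val_natAdd] at this
      omega
    have hne2 : (σ (Fin.natAdd (i + 1) b) : ℕ) ≠ σ (Fin.castAdd k (Fin.last i)) := by
      intro h
      have := σ.injective (Fin.ext h)
      simp only [Fin.ext_iff, Fin.val_castAdd, Fin.val_last, Fin.val_natAdd] at this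
      omega
    have hlt := (σ (Fin.natAdd (i + 1) b)).2
    refine ⟨_, _, Fin.natAdd (i + 1) b, (?_ : Fin.castAdd k (Fin.castSucc a) < Fin.castAdd k (Fin.last i)), ?_, ?_, ?_⟩ <;>
      simp only [Fin.lt_def, Fin.val_castAdd, Fin.val_castSucc, Fin.val_natAdd, Fin.val_last] <;> omega
  have hA : ∀ a : Fin i, k ≤ (σ (Fin.castAdd k (Fin.castSucc a)) : ℕ) := by
    intro a
    have := Finset.card_le_card_of_injOn (s := (univ : Finset (Fin k)))
      (t := range (σ (Fin.castAdd k (Fin.castSucc a)) : ℕ))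
      (fun b => (σ (Fin.natAdd (i + 1) b) : ℕ)) (fun b _ => by simpa using key a b)
      (fun b _ b' _ h => by simpa [Fin.ext_iff] using σ.injective (Fin.ext h))
    simpa using this
  have hA2 : ∀ a : Fin i, (σ (Fin.castAdd k (Fin.castSucc a)) : ℕ) < i + k := by
    intro a
    have hne2 : (σ (Fin.castAdd k (Fin.castSucc a)) : ℕ) ≠ σ (Fin.castAdd k (Fin.last i)) := by
      intro h
      have := σ.injective (Fin.ext h)
      simp only [Fin.ext_iff, Fin.val_castAdd, Fin.val_last, Fin.val_castSucc] at this
      omega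
    have hlt := (σ (Fin.castAdd k (Fin.castSucc a))).2
    omega
  have hB : ∀ b : Fin k, (σ (Fin.natAdd (i + 1) b) : ℕ) < k := by
    intro b
    have hb := (σ (Fin.natAdd (i + 1) b)).2
    have hb' : (σ (Fin.natAdd (i + 1) b) : ℕ) ≠ i + k := by
      intro h
      rw [← hm] at h
      have := σ.injective (Fin.ext h)
      simp only [Fin.ext_iff, Fin.val_castAdd, Fin.val_last, Fin.val_natAdd] at this
      omega
    have := Finset.card_le_card_of_injOn (s := (univ : Finset (Fin i)))
      (t := Finset.Ioo (σ (Fin.natAdd (i + 1) b) : ℕ) (i + k))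
      (fun a => (σ (Fin.castAdd k (Fin.castSucc a)) : ℕ))
      (fun a _ => by simpa using ⟨key a b, hA2 a⟩)
      (fun a _ a' _ h => by simpa [Fin.ext_iff] using σ.injective (Fin.ext h))
    simp at this
    omega
  let f : Fin i → Fin i := fun a => ⟨(σ (Fin.castAdd k (Fin.castSucc a)) : ℕ) - k, by
    have := hA a; have := hA2 a; omega⟩
  let g : Fin k → Fin k := fun b => ⟨(σ (Fin.natAdd (i + 1) b) : ℕ), hB b⟩
  have hf : Function.Injective f := by
    intro a a' h
    simp only [f, Fin.mk.injEq] at h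
    have h1 := hA a
    have h2 := hA a'
    have := σ.injective (Fin.ext (by omega : (σ (Fin.castAdd k (Fin.castSucc a)) : ℕ) = σ (Fin.castAdd k (Fin.castSucc a'))))
    simpa [Fin.ext_iff] using this
  have hg : Function.Injective g := by
    intro a a' h
    simp only [g, Fin.mk.injEq] at h
    simpa [Fin.ext_iff] using σ.injective (Fin.ext h)
  refine ⟨Equiv.ofBijective f (Finite.injective_iff_bijective.1 hf),
    Equiv.ofBijective g (Finite.injective_iff_bijective.1 hg), ?_⟩
  apply Equiv.ext
  rw [forall_pos]
  refine ⟨fun a => Fin.ext ?_, Fin.ext ?_, fun b => Fin.ext ?_⟩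
  · rw [comb_left]
    have := hA a
    simp only [Equiv.ofBijective_apply, f]
    omega
  · rw [comb_mid, hm]
  · rw [comb_right]
    simp only [Equiv.ofBijective_apply, g]

lemma comb_inj {i k : ℕ} {τ τ' : Equiv.Perm (Fin i)} {ρ ρ' : Equiv.Perm (Fin k)}
    (h : comb τ ρ = comb τ' ρ') : τ = τ' ∧ ρ = ρ' := by
  constructor
  · ext a
    have := comb_left τ ρ a
    rw [h, comb_left] at this
    omega
  · ext a
    have := comb_right τ ρ a
    rw [h, comb_right] at this
    omega

lemma fiber_sum (N i k : ℕ) (h : N = i + 1 + k) (hi : i < N) (a b c d : ℕ) :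
    ∑ σ ∈ Av132 N with ((σ ⟨i, hi⟩ : Fin N) : ℕ) = i + k, (X : Polynomial ℤ) ^ mmp a b c d σ =
      Q i (a - 1) b c (d - k) * (if a = 0 ∧ b = 0 ∧ c ≤ i ∧ d ≤ k then X else 1) *
        Q k a (b - (i + 1)) c d := by
  subst h
  have h0 : (⟨i, hi⟩ : Fin (i + 1 + k)) = Fin.castAdd k (Fin.last i) := rfl
  rw [h0]
  symm
  unfold Q
  rw [Finset.sum_mul, Finset.sum_mul_sum, ← Finset.sum_product']
  apply Finset.sum_bij (fun p _ => comb p.1 p.2)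
  · rintro ⟨τ, ρ⟩ hp
    simp only [Av132, mem_product, mem_filter, mem_univ, true_and] at hp ⊢
    exact ⟨(avoids_comb _ _).2 hp, comb_mid _ _⟩
  · rintro ⟨τ, ρ⟩ _ ⟨τ', ρ'⟩ _ h
    obtain ⟨h1, h2⟩ := comb_inj h
    exact Prod.ext h1 h2
  · intro σ hσ
    simp only [Av132, mem_filter, mem_univ, true_and] at hσ
    obtain ⟨τ, ρ, rfl⟩ := comb_surj σ hσ.1 hσ.2
    refine ⟨(τ, ρ), ?_, rfl⟩
    simpa [Av132] using (avoids_comb _ _).1 hσ.1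
  · rintro ⟨τ, ρ⟩ _
    simp only [mmp_comb, pow_add]
    congr 2
    split_ifs <;> simp

lemma Q_succ (n a b c d : ℕ) : Q (n + 1) a b c d = ∑ k ∈ range (n + 1),
    Q (n - k) (a - 1) b c (d - k) * (if a = 0 ∧ b = 0 ∧ c ≤ n - k ∧ d ≤ k then X else 1) *
        Q k a (b - (n - k + 1)) c d := by
  rw [← Finset.sum_range_reflect]
  rw [← Fin.sum_univ_eq_sum_range (fun j => Q (n - (n + 1 - 1 - j)) (a - 1) b c (d - (n + 1 - 1 - j)) *
    (if a = 0 ∧ b = 0 ∧ c ≤ n - (n + 1 - 1 - j) ∧ d ≤ (n + 1 - 1 - j) then X else 1) *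
        Q (n + 1 - 1 - j) a (b - (n - (n + 1 - 1 - j) + 1)) c d)]
  have : Q (n + 1) a b c d = ∑ j : Fin (n + 1), ∑ σ ∈ Av132 (n + 1) with σ.symm (Fin.last n) = j,
      (X : Polynomial ℤ) ^ mmp a b c d σ := by
    rw [Finset.sum_fiberwise]; rfl
  rw [this]
  apply Finset.sum_congr rfl
  intro j _
  obtain ⟨j, hj⟩ := j
  obtain ⟨k, rfl⟩ : ∃ k, n = j + k := ⟨n - j, by omega⟩
  have h1 : j + k + 1 - 1 - j = k := by omega
  have h2 : j + k - k = j := by omega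
  simp only [h1, h2]
  rw [← fiber_sum (j + k + 1) j k (by omega) hj]
  apply Finset.sum_congr _ (fun _ _ => rfl)
  ext σ
  simp only [mem_filter, Equiv.symm_apply_eq, Fin.ext_iff, Fin.val_last]
  constructor <;> rintro ⟨h, h'⟩ <;> exact ⟨h, h'.symm⟩

lemma Q_zero (a b c d : ℕ) : Q 0 a b c d = 1 := by
  unfold Q
  have : Av132 0 = {1} := by
    ext σ
    simp only [Av132, mem_filter, mem_univ, true_and, mem_singleton, Subsingleton.elim σ 1, iff_true]
    rintro ⟨i, _⟩
    exact i.elim0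
  rw [this]
  simp [mmp]

lemma Q_eval (n : ℕ) : ∀ a b c d : ℕ, (Q n a b c d).eval 1 = (catalan n : ℤ) := by
  induction n using Nat.strong_induction_on with
  | _ n ih =>
    intro a b c d
    cases n with
    | zero => simp [Q_zero]
    | succ n =>
      rw [Q_succ, catalan_succ', Finset.Nat.sum_antidiagonal_eq_sum_range_succ_mk,
        ← Finset.sum_range_reflect, Polynomial.eval_finsetSum]
      push_cast
      apply Finset.sum_congr rfl
      intro k hk
      have hk' : k ≤ n := by simpa [Nat.lt_succ_iff] using hk
      rw [eval_mul, eval_mul, ih _ (by omega), ih _ (by omega)]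
      have : n - (n - k) = k := by omega
      split_ifs <;> simp [this]

lemma mmp_le {n : ℕ} (a b c d : ℕ) (σ : Equiv.Perm (Fin n)) : mmp a b c d σ ≤ n - c - b - d := by
  unfold mmp
  have := Finset.card_le_card_of_injOn (s := univ.filter (MatchesMMP a b c d σ))
      (t := Finset.Ico (b + c) (n - d)) (fun i => (i : ℕ)) (fun i hi => by
        simp only [coe_filter, mem_univ, true_and, Set.mem_ofPred_eq] at hi
        obtain ⟨-, h2, h3, h4⟩ := hi
        simp only [coe_Ico, Set.mem_Ico]
        constructor
        · have h := Finset.card_le_card (s := (univ.filter fun j => j < i ∧ σ i < σ j) ∪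
            (univ.filter fun j => j < i ∧ σ j < σ i)) (t := Finset.Iio i) (by
              intro j; simp only [mem_union, mem_filter, mem_univ, true_and, mem_Iio]; tauto)
          rw [Finset.card_union_of_disjoint, Fin.card_Iio] at h
          · omega
          · rw [Finset.disjoint_left]
            intro j; simp only [mem_filter, mem_univ, true_and]
            intro h h'
            exact lt_asymm h.2 h'.2
        · have h := Finset.card_le_card (s := (univ.filter fun j => i < j ∧ σ j < σ i))
            (t := Finset.Ioi i) (by
              intro j; simp only [mem_filter, mem_univ, true_and, mem_Ioi]; tauto)
          rw [Fin.card_Ioi] at h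
          omega) (fun i _ j _ h => Fin.ext h)
  rw [Nat.card_Ico] at this
  omega

lemma Q_deg (n a b c d : ℕ) : (Q n a b c d).natDegree ≤ n - c - b - d := by
  unfold Q
  apply Polynomial.natDegree_sum_le_of_forall_le
  intro σ _
  rw [natDegree_X_pow]
  exact mmp_le a b c d σ

lemma Q_const (n a b c d : ℕ) (h : n - c - b - d = 0) : Q n a b c d = Polynomial.C (catalan n : ℤ) := by
  have h1 := Q_deg n a b c d
  rw [h] at h1
  have h2 := Polynomial.eq_C_of_natDegree_le_zero h1
  have h3 := Q_eval n a b c d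
  rw [h2, eval_C] at h3
  rw [h2, h3]

lemma Q_rec0 (n l d : ℕ) : Q (n + 1) 0 0 l d = ∑ k ∈ range (n + 1),
    Q (n - k) 0 0 l (d - k) * (if l ≤ n - k ∧ d ≤ k then X else 1) * Q k 0 0 l d := by
  rw [Q_succ]; simp

lemma Q_rec1 (n l d : ℕ) : Q (n + 1) 0 1 l d = ∑ k ∈ range (n + 1),
    Q (n - k) 0 1 l (d - k) * Q k 0 0 l d := by
  rw [Q_succ]; simp

lemma coeff_zero0 (n l d k m : ℕ)
    (h : (n - k - l - (d - k)) + (if l ≤ n - k ∧ d ≤ k then 1 else 0) + (k - l - d) < m) :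
    (Q (n - k) 0 0 l (d - k) * (if l ≤ n - k ∧ d ≤ k then X else 1) * Q k 0 0 l d).coeff m = 0 := by
  apply Polynomial.coeff_eq_zero_of_natDegree_lt
  have h1 := Q_deg (n - k) 0 0 l (d - k)
  have h2 := Q_deg k 0 0 l d
  refine lt_of_le_of_lt (Polynomial.natDegree_mul_le.trans (Nat.add_le_add_right Polynomial.natDegree_mul_le _)) ?_
  split_ifs at h ⊢
  · rw [natDegree_X]; omega
  · rw [natDegree_one]; omega

lemma coeff_zero1 (n l d k m : ℕ)
    (h : (n - k - l - 1 - (d - k)) + (k - l - d) < m) :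
    (Q (n - k) 0 1 l (d - k) * Q k 0 0 l d).coeff m = 0 := by
  apply Polynomial.coeff_eq_zero_of_natDegree_lt
  have h1 := Q_deg (n - k) 0 1 l (d - k)
  have h2 := Q_deg k 0 0 l d
  refine lt_of_le_of_lt Polynomial.natDegree_mul_le ?_
  omega


lemma t00 (l m : ℕ) (hl : 2 ≤ l) : (Q (l + m) 0 0 l 0).coeff m = (catalan l : ℤ) := by
  induction m with
  | zero => rw [Q_const _ _ _ _ _ (by omega)]; simp
  | succ m ih =>
    rw [← add_assoc, Q_rec0, finsetSum_coeff, Finset.sum_eq_single 0]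
    · simp [Q_zero, ih]
    · intro k hk hk0
      rw [mem_range] at hk
      apply coeff_zero0
      split_ifs <;> omega
    · simp

lemma t01 (l m : ℕ) (hl : 2 ≤ l) : (Q (l + 2 + m) 0 0 l 1).coeff (m + 1) = (catalan l : ℤ) := by
  rw [show l + 2 + m = (l + m + 1) + 1 by ring, Q_rec0, finsetSum_coeff, Finset.sum_eq_single 1]
  · rw [Q_const 1 _ _ _ _ (by omega), show l + m + 1 - 1 = l + m by omega]
    simp [t00 l m hl]
  · intro k hk hk0
    rw [mem_range] at hk
    apply coeff_zero0
    split_ifs <;> omega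
  · simp

lemma catalan_two' : catalan 2 = 2 := catalan_two
lemma catalan_three' : catalan 3 = 5 := catalan_three

lemma t02 (l m : ℕ) (hl : 2 ≤ l) : (Q (l + 3 + m) 0 0 l 2).coeff (m + 1) = 2 * (catalan l : ℤ) := by
  rw [show l + 3 + m = (l + m + 2) + 1 by ring, Q_rec0, finsetSum_coeff, Finset.sum_eq_single 2]
  · rw [Q_const 2 _ _ _ _ (by omega), show l + m + 2 - 2 = l + m by omega, coeff_mul_C]
    simp [t00 l m hl, mul_comm, catalan_two']
  · intro k hk hk0
    rw [mem_range] at hk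
    apply coeff_zero0
    split_ifs <;> omega
  · intro h; simp at h

lemma t12 (l m : ℕ) (hl : 2 ≤ l) : (Q (l + 4 + m) 0 1 l 2).coeff (m + 1) = 2 * (catalan l : ℤ) := by
  rw [show l + 4 + m = (l + 3 + m) + 1 by ring, Q_rec1, finsetSum_coeff,
    Finset.sum_eq_single (l + 3 + m)]
  · rw [Nat.sub_self, Q_zero, one_mul, t02 l m hl]
  · intro k hk hk0
    rw [mem_range] at hk
    apply coeff_zero1
    omega
  · intro h; simp at h

lemma t11 (l m : ℕ) (hl : 2 ≤ l) : (Q (l + 3 + m) 0 1 l 1).coeff (m + 1) = (catalan l : ℤ) := by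
  rw [show l + 3 + m = (l + 2 + m) + 1 by ring, Q_rec1, finsetSum_coeff,
    Finset.sum_eq_single (l + 2 + m)]
  · rw [Nat.sub_self, Q_zero, one_mul, t01 l m hl]
  · intro k hk hk0
    rw [mem_range] at hk
    apply coeff_zero1
    omega
  · intro h; simp at h

lemma t10 (l m : ℕ) (hl : 2 ≤ l) : (Q (l + 2 + m) 0 1 l 0).coeff (m + 1) = (catalan l : ℤ) := by
  rw [show l + 2 + m = (l + (m + 1)) + 1 by ring, Q_rec1, finsetSum_coeff,
    Finset.sum_eq_single (l + (m + 1))]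
  · rw [Nat.sub_self, Q_zero, one_mul, t00 l _ hl]
  · intro k hk hk0
    rw [mem_range] at hk
    apply coeff_zero1
    omega
  · intro h; simp at h

/-- constant term at `n = l + 1` -/
lemma s00_base (l : ℕ) (hl : 2 ≤ l) :
    (Q (l + 1) 0 0 l 0).coeff 0 = (catalan (l + 1) : ℤ) - catalan l := by
  have h1 := Q_eval (l + 1) 0 0 l 0
  have h2 := Q_deg (l + 1) 0 0 l 0
  rw [eval_eq_sum_range' (n := 2) (by omega)] at h1
  have h3 := t00 l 1 hl
  simp [Finset.sum_range_succ] at h1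
  linarith

lemma s00 (l m : ℕ) (hl : 2 ≤ l) : (Q (l + 1 + m) 0 0 l 0).coeff m =
    (catalan (l + 1) : ℤ) - catalan l + 2 * catalan l * m := by
  induction m with
  | zero => simpa using s00_base l hl
  | succ m ih =>
    rw [← add_assoc, Q_rec0, finsetSum_coeff,
      ← Finset.sum_subset (s₁ := {0, 1, l + 1 + m})]
    · rw [Finset.sum_insert (by simp; omega), Finset.sum_insert (by simp; omega),
        Finset.sum_singleton]
      rw [Nat.sub_self (l + 1 + m), Q_zero, Q_zero, Q_const 1 _ _ _ _ (by omega),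
        show l + 1 + m - 1 = l + m by omega, Nat.sub_zero]
      rw [if_pos (by omega), if_pos (by omega), if_neg (by omega)]
      have h := t00 l (m + 1) hl
      rw [show l + (m + 1) = l + 1 + m by ring] at h
      simp [ih, h, t00 l m hl]
      ring
    · intro k; simp; omega
    · intro k hk hk0
      simp only [mem_range, mem_insert, mem_singleton] at hk hk0
      apply coeff_zero0
      split_ifs <;> omega

lemma s02 (l m : ℕ) (hl : 2 ≤ l) : (Q (l + 4 + m) 0 0 l 2).coeff (m + 1) =
    2 * (catalan (l + 1) : ℤ) + 8 * catalan l + 4 * catalan l * m := by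
  rw [show l + 4 + m = (l + 3 + m) + 1 by ring, Q_rec0, finsetSum_coeff,
      ← Finset.sum_subset (s₁ := {0, 1, 2, 3, l + 3 + m})]
  · rw [Finset.sum_insert (by simp; omega), Finset.sum_insert (by simp; omega),
      Finset.sum_insert (by simp; omega), Finset.sum_insert (by simp; omega),
      Finset.sum_singleton]
    rw [Nat.sub_self (l + 3 + m), Q_zero, Q_zero, Q_const 1 _ _ _ _ (by omega), Q_const 2 _ _ _ _ (by omega),
      Q_const 3 _ _ _ _ (by omega),
      show l + 3 + m - 1 = l + 2 + m by omega, show l + 3 + m - 2 = l + 1 + m by omega,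
      show l + 3 + m - 3 = l + m by omega, Nat.sub_zero]
    rw [if_neg (by omega), if_neg (by omega), if_pos (by omega), if_pos (by omega),
      if_neg (by omega)]
    simp [coeff_mul_C, -map_natCast, catalan_two', catalan_three', s00 l m hl, t00 l m hl, t01 l m hl, t02 l m hl]
    ring
  · intro k; simp; omega
  · intro k hk hk0
    simp only [mem_range, mem_insert, mem_singleton] at hk hk0
    apply coeff_zero0
    split_ifs <;> omega

lemma s12 (l m : ℕ) (hl : 2 ≤ l) : (Q (l + 5 + m) 0 1 l 2).coeff (m + 1) =
    2 * (catalan (l + 1) : ℤ) + 15 * catalan l + 4 * catalan l * m := by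
  rw [show l + 5 + m = (l + 4 + m) + 1 by ring, Q_rec1, finsetSum_coeff,
      ← Finset.sum_subset (s₁ := {0, 1, 2, l + 3 + m, l + 4 + m})]
  · rw [Finset.sum_insert (by simp; omega), Finset.sum_insert (by simp; omega),
      Finset.sum_insert (by simp; omega), Finset.sum_insert (by simp),
      Finset.sum_singleton]
    rw [Nat.sub_self (l + 4 + m), Q_zero, Q_zero, Q_const 1 _ _ _ _ (by omega), Q_const 2 _ _ _ _ (by omega),
      show l + 4 + m - (l + 3 + m) = 1 by omega, Q_const 1 _ _ _ _ (by omega),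
      show l + 4 + m - 1 = l + 3 + m by omega, show l + 4 + m - 2 = l + 2 + m by omega,
      Nat.sub_zero]
    simp [coeff_mul_C, -map_natCast, catalan_two', catalan_three', s02 l m hl, t12 l m hl, t11 l m hl, t02 l m hl,
      t10 l m hl]
    ring
  · intro k; simp; omega
  · intro k hk hk0
    simp only [mem_range, mem_insert, mem_singleton] at hk hk0
    apply coeff_zero1
    omega

/-- for `ℓ ≥ 2` and `n ≥ 5 + ℓ`, the coefficient of `x^{n-4-ℓ}` in
`Q_{n,132}^{(0,1,ℓ,2)}(x)` equals `2·C_{ℓ+1} + 15·C_ℓ + 4·C_ℓ·(n-5-ℓ)`. -/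
theorem stmt14 (l n : ℕ) (hl : 2 ≤ l) (hn : 5 + l ≤ n) :
    (Q n 0 1 l 2).coeff (n - 4 - l) =
      ((2 * catalan (l + 1) + 15 * catalan l
        + 4 * catalan l * (n - 5 - l) : ℕ) : ℤ) := by
  obtain ⟨m, rfl⟩ : ∃ m, n = l + 5 + m := ⟨n - l - 5, by omega⟩
  rw [show l + 5 + m - 4 - l = m + 1 by omega, show l + 5 + m - 5 - l = m by omega, s12 l m hl]
  push_cast
  ring
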